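/- Conditional Lindeberg condition: in the bandit model, fix an arm k, let S_{Tt} = a_{k,T}^{−1} 1{A_t = k} ℓ̇_{θ,k}(Z_{k,t}) with Z_{k,t} independent of 𝒢_{T,t−1} = σ(F_{t−1}, A_t) and i.i.d. with E_θ[|ℓ̇_{θ,k}(Z_k)|²] < ∞. If (u_T) is a bounded sequence in ℝ^p, a_{k,T} → ∞, and D_{k,T}/a_{k,T}² is bounded in probability, then for every δ > 0, Σ_{t=1}^T E[|u_Tᵀ S_{Tt}|² 1{|u_Tᵀ S_{Tt}| > δ} | 𝒢_{T,t−1}] = (D_{k,T}/a_{k,T}²) · E[|u_Tᵀ ℓ̇_{θ,k}(Z_{k,1})|² 1{|u_Tᵀ ℓ̇_{θ,k}(Z_{k,1})| > a_{k,T} δ}] converges to 0 in probability as T → ∞. -/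

import Mathlib

open MeasureTheory ProbabilityTheory Filter

/-- Conditional expectation of `g (Z)` restricted to an `m`-measurable event, for `Z` independent
of `m`. -/
theorem condExp_indicator_comp_of_indep {Ω : Type*} {m m0 : MeasurableSpace Ω} {P : Measure Ω}
    [IsProbabilityMeasure P] (hm : m ≤ m0) {Z : Ω → ℝ} (hZ : Measurable Z)
    (hindep : Indep (MeasurableSpace.comap Z inferInstance) m P) {s : Set Ω}
    (hs : MeasurableSet[m] s) {g : ℝ → ℝ} (hgm : Measurable g)
    (hg : Integrable g (Measure.map Z P)) :
    P[s.indicator (fun ω => g (Z ω)) | m]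
      =ᵐ[P] s.indicator fun _ => ∫ z, g z ∂(Measure.map Z P) := by
  have hint : Integrable (fun ω => g (Z ω)) P := hg.comp_measurable hZ
  have hconst : P[fun ω => g (Z ω) | m] =ᵐ[P] fun _ => ∫ ω, g (Z ω) ∂P :=
    condExp_indep_eq hZ.comap_le hm
      (hgm.comp (comap_measurable Z)).stronglyMeasurable hindep
  rw [integral_map hZ.aemeasurable hgm.aestronglyMeasurable]
  filter_upwards [condExp_indicator hint hs, hconst] with ω h1 h2
  rw [h1]
  by_cases hω : ω ∈ s <;> simp [hω, h2]

/-- A sequence bounded above in probability and nonnegative, times a deterministic null sequence,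
tends to zero in measure. -/
theorem tendstoInMeasure_mul_of_bounded_of_tendsto_zero {Ω : Type*} [MeasurableSpace Ω]
    {P : Measure Ω} {X : ℕ → Ω → ℝ} (hX : ∀ T ω, 0 ≤ X T ω)
    (hbound : ∀ ε : ℝ, 0 < ε → ∃ M : ℝ, ∀ T, P {ω | M < X T ω} ≤ ENNReal.ofReal ε)
    {c : ℕ → ℝ} (hc : Tendsto c atTop (nhds 0)) :
    TendstoInMeasure P (fun T ω => X T ω * c T) atTop 0 := by
  rw [tendstoInMeasure_iff_norm]
  intro ε hε
  rw [ENNReal.tendsto_nhds_zero]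
  intro η hη
  obtain ⟨r, hr, hrη⟩ : ∃ r : ℝ, 0 < r ∧ ENNReal.ofReal r ≤ η := by
    rcases eq_or_ne η ⊤ with rfl | htop
    · exact ⟨1, one_pos, le_top⟩
    · exact ⟨η.toReal, ENNReal.toReal_pos hη.ne' htop, (ENNReal.ofReal_toReal htop).le⟩
  obtain ⟨M, hM⟩ := hbound r hr
  have hlim : Tendsto (fun T => M * |c T|) atTop (nhds 0) := by
    simpa using hc.abs.const_mul M
  filter_upwards [hlim.eventually_lt_const hε] with T hT
  refine (measure_mono fun ω hω => ?_).trans ((hM T).trans hrη)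
  simp only [Set.mem_ofPred_eq, Pi.zero_apply, sub_zero, norm_mul, Real.norm_eq_abs,
    abs_of_nonneg (hX T ω)] at hω ⊢
  by_contra! hle
  exact (hω.trans (mul_le_mul_of_nonneg_right hle (abs_nonneg _))).not_gt hT

theorem abs_sum_mul_le_card_mul_norm_mul_norm {ι : Type*} [Fintype ι] (u v : ι → ℝ) :
    |∑ j, u j * v j| ≤ Fintype.card ι * ‖u‖ * ‖v‖ := by
  calc |∑ j, u j * v j| ≤ ∑ j, |u j * v j| := Finset.abs_sum_le_sum_abs _ _
    _ ≤ ∑ _j : ι, ‖u‖ * ‖v‖ := Finset.sum_le_sum fun j _ => by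
        rw [abs_mul]
        exact mul_le_mul (norm_le_pi_norm u j) (norm_le_pi_norm v j) (abs_nonneg _)
          (norm_nonneg _)
    _ = Fintype.card ι * ‖u‖ * ‖v‖ := by simp [mul_assoc]

theorem sq_indicator_le_of_abs_le {α : Type*} (s : Set α) {f : α → ℝ} {x : α} {b : ℝ}
    (h : |f x| ≤ b) : ‖s.indicator (fun y => f y ^ 2) x‖ ≤ b ^ 2 := by
  refine (norm_indicator_le_norm_self _ _).trans ?_
  rw [norm_pow, Real.norm_eq_abs]
  gcongr

/-- Truncated second moments of functions with a common square-integrable envelope vanish as the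
truncation level tends to infinity. -/
theorem tendsto_integral_indicator_sq_of_envelope {α : Type*} [MeasurableSpace α]
    {μ : Measure α} {f : ℕ → α → ℝ} (hf : ∀ n, Measurable (f n)) {b : α → ℝ}
    (hfb : ∀ n x, |f n x| ≤ b x) (hb : Integrable (fun x => b x ^ 2) μ)
    {r : ℕ → ℝ} (hr : Tendsto r atTop atTop) :
    Tendsto (fun n => ∫ x, Set.indicator {y | r n < |f n y|} (fun y => f n y ^ 2) x ∂μ)
      atTop (nhds 0) := by
  rw [← integral_zero α ℝ (μ := μ)]
  refine tendsto_integral_of_dominated_convergence (fun x => b x ^ 2) (fun n => ?_) hb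
    (fun n => ae_of_all _ fun x => sq_indicator_le_of_abs_le _ (hfb n x))
    (ae_of_all _ fun x => ?_)
  · exact (((hf n).pow_const 2).indicator
      (measurableSet_lt measurable_const (hf n).abs)).aestronglyMeasurable
  · refine tendsto_const_nhds.congr' ?_
    filter_upwards [hr.eventually_ge_atTop (b x)] with n hn
    rw [Set.indicator_of_notMem]
    exact not_lt.mpr ((hfb n x).trans hn)

/-- **conditional Lindeberg condition.** With
`S_{Tt} = a_T⁻¹ 1{A_t = k} ℓ̇_{θ,k}(Z_{k,t})`, `Z_{k,t}` i.i.d. with square-integrable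
score and independent of `𝒢_{T,t−1} = σ(F_{t−1}, A_t)`, `(u_T)` bounded, `a_T → ∞`, and
`D_{k,T}/a_T²` bounded in probability, for every `δ > 0` the sum of conditional truncated
second moments equals `(D_{k,T}/a_T²) · E[|u_Tᵀℓ̇(Z)|² 1{|u_Tᵀℓ̇(Z)| > a_T δ}]` a.s. and
converges to `0` in probability. -/
theorem stmt8 {Ω : Type*} [m0 : MeasurableSpace Ω] (P : Measure Ω) [IsProbabilityMeasure P]
    (K p : ℕ) (k : Fin K)
    (ν : Measure ℝ) [SigmaFinite ν]
    (fk : ℝ → ℝ) (hfkmeas : Measurable fk)                     -- density f_k(·|θ)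
    [IsProbabilityMeasure (ν.withDensity fun z => ENNReal.ofReal (fk z))]
    (Z : ℕ → Ω → ℝ) (hZmeas : ∀ t, Measurable (Z t))           -- Z_{k,·}
    (A : ℕ → Ω → Fin K) (hAmeas : ∀ t, Measurable (A t))
    (score : ℝ → Fin p → ℝ) (hscoremeas : Measurable score)    -- ℓ̇_{θ,k}
    (𝒢 : ℕ → MeasurableSpace Ω) (h𝒢 : ∀ t, 𝒢 t ≤ m0)         -- 𝒢 t = σ(F_{t−1}, A_t)
    (hA𝒢 : ∀ t, MeasurableSet[𝒢 t] {ω | A t ω = k})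
    (hlaw : ∀ t, Measure.map (Z t) P = ν.withDensity fun z => ENNReal.ofReal (fk z))
    (hindep : ∀ t, Indep (MeasurableSpace.comap (Z t) inferInstance) (𝒢 t) P)
    (hL2 : Integrable (fun z => ‖score z‖ ^ 2)
      (ν.withDensity fun z => ENNReal.ofReal (fk z)))
    (u : ℕ → Fin p → ℝ) (hu : ∃ M : ℝ, ∀ T, ‖u T‖ ≤ M)
    (a : ℕ → ℝ) (hapos : ∀ T, 0 < a T) (ha : Tendsto a atTop atTop)
    (hDbound : ∀ ε : ℝ, 0 < ε → ∃ M : ℝ, ∀ T : ℕ,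
      P {ω | M < (∑ t ∈ Finset.Icc 1 T, if A t ω = k then (1 : ℝ) else 0) / (a T) ^ 2}
        ≤ ENNReal.ofReal ε) :
    ∀ δ : ℝ, 0 < δ →
      (∀ T : ℕ,
        (fun ω => ∑ t ∈ Finset.Icc 1 T,
            (P[fun ω' =>
                Set.indicator
                  {ω'' | δ < |(a T)⁻¹ *
                      (if A t ω'' = k then ∑ j, u T j * score (Z t ω'') j else 0)|}
                  (fun ω'' => ((a T)⁻¹ *
                      (if A t ω'' = k then ∑ j, u T j * score (Z t ω'') j else 0)) ^ 2)
                  ω' | 𝒢 t]) ω)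
          =ᵐ[P] fun ω =>
            ((∑ t ∈ Finset.Icc 1 T, if A t ω = k then (1 : ℝ) else 0) / (a T) ^ 2)
              * ∫ z, Set.indicator {z' | a T * δ < |∑ j, u T j * score z' j|}
                  (fun z' => (∑ j, u T j * score z' j) ^ 2) z
                  ∂(ν.withDensity fun z => ENNReal.ofReal (fk z)))
      ∧ TendstoInMeasure P
          (fun T ω => ∑ t ∈ Finset.Icc 1 T,
            (P[fun ω' =>
                Set.indicator
                  {ω'' | δ < |(a T)⁻¹ *
                      (if A t ω'' = k then ∑ j, u T j * score (Z t ω'') j else 0)|}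
                  (fun ω'' => ((a T)⁻¹ *
                      (if A t ω'' = k then ∑ j, u T j * score (Z t ω'') j else 0)) ^ 2)
                  ω' | 𝒢 t]) ω)
          atTop 0 := by
  intro δ hδ
  set μ := ν.withDensity fun z => ENNReal.ofReal (fk z) with hμ
  obtain ⟨M, hM⟩ := hu
  have hwmeas : ∀ T, Measurable fun z => ∑ j, u T j * score z j := fun T =>
    Finset.measurable_sum _ fun j _ => ((measurable_pi_apply j).comp hscoremeas).const_mul _
  have hwbound : ∀ T z, |∑ j, u T j * score z j| ≤ p * M * ‖score z‖ := fun T z => by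
    refine (abs_sum_mul_le_card_mul_norm_mul_norm (u T) (score z)).trans ?_
    rw [Fintype.card_fin]
    gcongr
    exact hM T
  have henv : Integrable (fun z => (p * M * ‖score z‖) ^ 2) μ := by
    simp_rw [mul_pow _ ‖_‖]
    exact hL2.const_mul _
  have hgmeas : ∀ T, Measurable (Set.indicator {z' | a T * δ < |∑ j, u T j * score z' j|}
      fun z' => (∑ j, u T j * score z' j) ^ 2) := fun T =>
    ((hwmeas T).pow_const 2).indicator (measurableSet_lt measurable_const (hwmeas T).abs)
  have hgint : ∀ T, Integrable (Set.indicator {z' | a T * δ < |∑ j, u T j * score z' j|}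
      fun z' => (∑ j, u T j * score z' j) ^ 2) μ := fun T =>
    henv.mono' (hgmeas T).aestronglyMeasurable
      (ae_of_all _ fun z => sq_indicator_le_of_abs_le _ (hwbound T z))
  have hsummand : ∀ T t, (fun ω' => Set.indicator
        {ω'' | δ < |(a T)⁻¹ * (if A t ω'' = k then ∑ j, u T j * score (Z t ω'') j else 0)|}
        (fun ω'' => ((a T)⁻¹ *
          (if A t ω'' = k then ∑ j, u T j * score (Z t ω'') j else 0)) ^ 2) ω')
      = {ω | A t ω = k}.indicator fun ω => ((a T)⁻¹) ^ 2 *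
          Set.indicator {z' | a T * δ < |∑ j, u T j * score z' j|}
            (fun z' => (∑ j, u T j * score z' j) ^ 2) (Z t ω) := by
    intro T t
    funext ω
    by_cases hω : A t ω = k
    · have hiff : δ < |(a T)⁻¹ * ∑ j, u T j * score (Z t ω) j|
          ↔ a T * δ < |∑ j, u T j * score (Z t ω) j| := by
        rw [abs_mul, abs_of_pos (inv_pos.mpr (hapos T)), lt_inv_mul_iff₀ (hapos T)]
      simp only [Set.indicator_apply, Set.mem_ofPred_eq, hω, if_true, hiff, mul_pow, mul_ite,
        mul_zero]
    · simp [Set.indicator_apply, hω]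
  have heq : ∀ T : ℕ, (fun ω => ∑ t ∈ Finset.Icc 1 T,
            (P[fun ω' =>
                Set.indicator
                  {ω'' | δ < |(a T)⁻¹ *
                      (if A t ω'' = k then ∑ j, u T j * score (Z t ω'') j else 0)|}
                  (fun ω'' => ((a T)⁻¹ *
                      (if A t ω'' = k then ∑ j, u T j * score (Z t ω'') j else 0)) ^ 2)
                  ω' | 𝒢 t]) ω)
          =ᵐ[P] fun ω =>
            ((∑ t ∈ Finset.Icc 1 T, if A t ω = k then (1 : ℝ) else 0) / (a T) ^ 2)
              * ∫ z, Set.indicator {z' | a T * δ < |∑ j, u T j * score z' j|}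
                  (fun z' => (∑ j, u T j * score z' j) ^ 2) z ∂μ := by
    intro T
    have hcond : ∀ t, P[{ω | A t ω = k}.indicator fun ω => ((a T)⁻¹) ^ 2 *
          Set.indicator {z' | a T * δ < |∑ j, u T j * score z' j|}
            (fun z' => (∑ j, u T j * score z' j) ^ 2) (Z t ω) | 𝒢 t]
        =ᵐ[P] {ω | A t ω = k}.indicator fun _ => ∫ z, ((a T)⁻¹) ^ 2 *
          Set.indicator {z' | a T * δ < |∑ j, u T j * score z' j|}
            (fun z' => (∑ j, u T j * score z' j) ^ 2) z ∂(Measure.map (Z t) P) := fun t =>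
      condExp_indicator_comp_of_indep (h𝒢 t) (hZmeas t) (hindep t) (hA𝒢 t)
        ((hgmeas T).const_mul (((a T)⁻¹) ^ 2))
        (by rw [hlaw t]; exact (hgint T).const_mul _)
    simp only [hsummand, hlaw, integral_const_mul] at hcond ⊢
    filter_upwards [ae_all_iff.mpr hcond] with ω hω
    rw [div_eq_mul_inv, Finset.sum_mul, Finset.sum_mul]
    refine Finset.sum_congr rfl fun t _ => ?_
    rw [hω t]
    by_cases hA : A t ω = k <;> simp [Set.indicator_apply, hA]
  refine ⟨heq, TendstoInMeasure.congr_left (fun T => (heq T).symm) ?_⟩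
  refine tendstoInMeasure_mul_of_bounded_of_tendsto_zero (fun T ω => ?_) hDbound
    (tendsto_integral_indicator_sq_of_envelope hwmeas hwbound henv
      (ha.atTop_mul_const hδ))
  exact div_nonneg (Finset.sum_nonneg fun t _ => by split_ifs <;> simp) (sq_nonneg _)
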